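/- arXiv:2201.05879 — 9 statements merged into one kernel-verified Lean document; each statement's English description precedes it below -/
import Mathlib

section
/- Let n ≥ 1 and let α : [n] → [n] be a map whose image contains at least 3 elements. Then α is orientation-preserving (α ∈ OP_n) if and only if for every cyclic triple S = (i, j, k) of elements of [n], the image triple Sα = (iα, jα, kα) is cyclic. -/
/-- A finite sequence `a : Fin t → α` is *cyclic* if there is at most one index `i`
(indices modulo `t`) with `a i > a (i+1)`. -/
def IsCyclicSeq {t : ℕ} {α : Type*} [LinearOrder α] (a : Fin t → α) : Prop :=
  (Finset.univ.filter fun i : Fin t => a (finRotate t i) < a i).card ≤ 1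

/-- A finite sequence `a : Fin t → α` is *anti-cyclic* if there is at most one index `i`
(indices modulo `t`) with `a i < a (i+1)`. -/
def IsAntiCyclicSeq {t : ℕ} {α : Type*} [LinearOrder α] (a : Fin t → α) : Prop :=
  (Finset.univ.filter fun i : Fin t => a i < a (finRotate t i)).card ≤ 1

/-- A sequence is *oriented* if it is cyclic or anti-cyclic. -/
def IsOrientedSeq {t : ℕ} {α : Type*} [LinearOrder α] (a : Fin t → α) : Prop :=
  IsCyclicSeq a ∨ IsAntiCyclicSeq a

theorem isCyclicSeq_iff {t : ℕ} {α : Type*} [LinearOrder α] (a : Fin t → α) :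
    IsCyclicSeq a ↔
      ∀ p q : Fin t, a (finRotate t p) < a p → a (finRotate t q) < a q → p = q := by
  simp only [IsCyclicSeq, Finset.card_le_one, Finset.mem_filter, Finset.mem_univ, true_and]
  exact ⟨fun h p q hp hq => h p hp q hq, fun h p hp q hq => h p q hp hq⟩

/-- A triple fails to be cyclic exactly when it is a rotation of a strictly decreasing triple. -/
theorem isCyclicSeq_triple_iff {α : Type*} [LinearOrder α] (x y z : α) :
    IsCyclicSeq ![x, y, z] ↔
      ¬ (z < y ∧ y < x) ∧ ¬ (x < z ∧ z < y) ∧ ¬ (y < x ∧ x < z) := by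
  have h0 : finRotate 3 0 = 1 := by decide
  have h1 : finRotate 3 1 = 2 := by decide
  have h2 : finRotate 3 2 = 0 := by decide
  rw [isCyclicSeq_iff]
  simp only [Fin.forall_fin_succ, IsEmpty.forall_iff, Fin.succ_zero_eq_one,
    Fin.succ_one_eq_two, h0, h1, h2]
  simp
  grind

theorem val_finRotate_cases {n : ℕ} (p : Fin n) :
    ((finRotate n p).val = p.val + 1) ∨ (p.val + 1 = n ∧ (finRotate n p).val = 0) := by
  cases n with
  | zero => exact p.elim0
  | succ m =>
    rw [coe_finRotate]
    split_ifs with h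
    · simp [h]
    · simp

theorem exists_descent_of_lt {n : ℕ} {α : Type*} [LinearOrder α] (a : Fin n → α) {u v : Fin n}
    (huv : u ≤ v) (h : a v < a u) : ∃ p, u ≤ p ∧ p < v ∧ a (finRotate n p) < a p := by
  by_contra! hno
  have key : ∀ d : ℕ, ∀ w : Fin n, w.val = u.val + d → w ≤ v → a u ≤ a w := by
    intro d
    induction d with
    | zero =>
      intro w hw _
      rw [Fin.ext (a := w) (b := u) (by simpa using hw)]
    | succ d ih =>
      intro w hw hwv
      have hlt : u.val + d < n := by have := w.isLt; omega
      let w₀ : Fin n := ⟨u.val + d, hlt⟩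
      have hw₀ : w₀.val = u.val + d := rfl
      have hrot : finRotate n w₀ = w := by
        have := val_finRotate_cases w₀
        apply Fin.ext
        have := w.isLt
        omega
      have h₁ := ih w₀ hw₀ (by omega)
      have h₂ := hno w₀ (by omega) (by omega)
      rw [hrot] at h₂
      exact h₁.trans h₂
  exact (key (v.val - u.val) v (by omega) le_rfl).not_gt h

theorem exists_wrapping_descent_of_lt {n : ℕ} {α : Type*} [LinearOrder α] (a : Fin n → α)
    {u v : Fin n} (h : a u < a v) :
    ∃ p, (p < u ∨ v ≤ p) ∧ a (finRotate n p) < a p := by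
  by_contra! hno
  have hn := u.isLt
  let f : Fin n := ⟨0, by omega⟩
  let l : Fin n := ⟨n - 1, by omega⟩
  have hf : f.val = 0 := rfl
  have hl : l.val = n - 1 := rfl
  have hrot : finRotate n l = f := by
    have := val_finRotate_cases l
    have := (finRotate n l).isLt
    apply Fin.ext
    omega
  have h₁ : a v ≤ a l := by
    by_contra! hlt
    obtain ⟨p, hp, -, hd⟩ := exists_descent_of_lt a (by omega) hlt
    exact (hno p (Or.inr hp)).not_gt hd
  have h₂ : a l ≤ a f := hrot ▸ hno l (Or.inr (by omega))
  have h₃ : a f ≤ a u := by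
    by_contra! hlt
    obtain ⟨p, -, hp, hd⟩ := exists_descent_of_lt a (by omega) hlt
    exact (hno p (Or.inl hp)).not_gt hd
  exact ((h₁.trans h₂).trans h₃).not_gt h

theorem IsCyclicSeq.triple_of_lt {n : ℕ} {α : Type*} [LinearOrder α] {a : Fin n → α}
    (ha : IsCyclicSeq a) {i j k : Fin n} (hij : i < j) (hjk : j < k) :
    IsCyclicSeq ![a i, a j, a k] := by
  rw [isCyclicSeq_iff] at ha
  rw [isCyclicSeq_triple_iff]
  refine ⟨fun ⟨h₁, h₂⟩ => ?_, fun ⟨h₁, h₂⟩ => ?_, fun ⟨h₁, h₂⟩ => ?_⟩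
  · obtain ⟨p, _, _, hp⟩ := exists_descent_of_lt a hij.le h₂
    obtain ⟨q, _, _, hq⟩ := exists_descent_of_lt a hjk.le h₁
    have := ha p q hp hq
    omega
  · obtain ⟨p, _, hp⟩ := exists_wrapping_descent_of_lt a h₁
    obtain ⟨q, _, _, hq⟩ := exists_descent_of_lt a hjk.le h₂
    have := ha p q hp hq
    omega
  · obtain ⟨p, _, _, hp⟩ := exists_descent_of_lt a hij.le h₁
    obtain ⟨q, _, hq⟩ := exists_wrapping_descent_of_lt a h₂
    have := ha p q hp hq
    omega

theorem IsCyclicSeq.triple {n : ℕ} {α : Type*} [LinearOrder α] {a : Fin n → α}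
    (ha : IsCyclicSeq a) {i j k : Fin n} (h : IsCyclicSeq ![i, j, k]) :
    IsCyclicSeq ![a i, a j, a k] := by
  have h₁ := ha.triple_of_lt (i := i) (j := j) (k := k)
  have h₂ := ha.triple_of_lt (i := j) (j := k) (k := i)
  have h₃ := ha.triple_of_lt (i := k) (j := i) (k := j)
  simp only [isCyclicSeq_triple_iff] at h h₁ h₂ h₃ ⊢
  grind

theorem isCyclicSeq_of_triples {n : ℕ} {α : Type*} [LinearOrder α] {a : Fin n → α}
    (him : 3 ≤ (Finset.univ.image a).card)
    (h : ∀ i j k : Fin n, IsCyclicSeq ![i, j, k] → IsCyclicSeq ![a i, a j, a k]) :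
    IsCyclicSeq a := by
  simp only [isCyclicSeq_triple_iff] at h
  rw [isCyclicSeq_iff]
  intro p q hp hq
  by_contra hpq
  have between : ∀ r x : Fin n, a (finRotate n r) < a r →
      a (finRotate n r) ≤ a x ∧ a x ≤ a r := by
    intro r x hr
    have := h r (finRotate n r) x (by have := val_finRotate_cases r; omega)
    grind
  obtain ⟨x, hxp, hxp'⟩ : ∃ x, a x ≠ a p ∧ a x ≠ a (finRotate n p) := by
    by_contra! hx
    have hsub : Finset.univ.image a ⊆ {a p, a (finRotate n p)} := by
      intro y hy
      obtain ⟨x, -, rfl⟩ := Finset.mem_image.mp hy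
      have := hx x
      simp only [Finset.mem_insert, Finset.mem_singleton]
      tauto
    have := (Finset.card_le_card hsub).trans Finset.card_le_two
    omega
  have hmax : a q = a p := le_antisymm (between p q hp).2 (between q p hq).2
  have hmin : a (finRotate n q) = a (finRotate n p) :=
    le_antisymm (between q _ hq).1 (between p _ hp).1
  have hx := between p x hp
  have hlt : a x < a p := lt_of_le_of_ne hx.2 hxp
  have hgt : a (finRotate n p) < a x := lt_of_le_of_ne hx.1 (Ne.symm hxp')
  have hne₁ : x ≠ p := fun e => hxp (e ▸ rfl)
  have hne₂ : x ≠ q := fun e => hxp (e ▸ hmax)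
  have h₁ := h p x (finRotate n q)
  have h₂ := h q x (finRotate n p)
  rw [hmin] at h₁
  rw [hmax] at h₂
  have hp' := val_finRotate_cases p
  have hq' := val_finRotate_cases q
  rcases lt_or_gt_of_ne hpq with hlt' | hlt' <;>
    by_cases hx₁ : p < x <;> by_cases hx₂ : q < x <;>
    first
    | exact (h₁ (by omega)).1 ⟨hgt, hlt⟩
    | exact (h₂ (by omega)).1 ⟨hgt, hlt⟩


/-- For `n ≥ 1` and `α : [n] → [n]` with at least 3 elements in its image,
`α` is orientation-preserving iff the image of every cyclic triple is cyclic. -/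
theorem op_iff_cyclic_triples (n : ℕ) (hn : 1 ≤ n) (α : Fin n → Fin n)
    (him : 3 ≤ (Finset.univ.image α).card) :
    IsCyclicSeq α ↔
      ∀ i j k : Fin n, IsCyclicSeq ![i, j, k] → IsCyclicSeq ![α i, α j, α k] :=
  ⟨fun h _ _ _ => h.triple, isCyclicSeq_of_triples him⟩
end

section
/- Let n ≥ 1 and let α : [n] → [n] be a map whose image contains at least 3 elements. Then α is orientation-reversing (α ∈ OR_n) if and only if for every cyclic triple S = (i, j, k) of elements of [n], the image triple Sα = (iα, jα, kα) is anti-cyclic. -/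
/-- `StrictCyc a b c` says that `a`, `b`, `c` are distinct and increase up to rotation. -/
def StrictCyc {β : Type*} [LinearOrder β] (a b c : β) : Prop :=
  (a < b ∧ b < c) ∨ (b < c ∧ c < a) ∨ (c < a ∧ a < b)

theorem isAntiCyclicSeq_triple {β : Type*} [LinearOrder β] (a b c : β) :
    IsAntiCyclicSeq ![a, b, c] ↔ ¬ StrictCyc a b c := by
  have h : (finRotate 3 0 = 1) ∧ (finRotate 3 1 = 2) ∧ (finRotate 3 2 = 0) := by decide
  unfold IsAntiCyclicSeq StrictCyc
  rw [Finset.card_filter, Fin.sum_univ_three, h.1, h.2.1, h.2.2]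
  simp only [Matrix.cons_val]
  grind

theorem isCyclicSeq_triple {β : Type*} [LinearOrder β] (a b c : β) :
    IsCyclicSeq ![a, b, c] ↔ ¬ StrictCyc c b a := by
  have h : (finRotate 3 0 = 1) ∧ (finRotate 3 1 = 2) ∧ (finRotate 3 2 = 0) := by decide
  unfold IsCyclicSeq StrictCyc
  rw [Finset.card_filter, Fin.sum_univ_three, h.1, h.2.1, h.2.2]
  simp only [Matrix.cons_val]
  grind

theorem forall_isCyclicSeq_triple_iff {β γ : Type*} [LinearOrder β] [LinearOrder γ] (f : β → γ) :
    (∀ i j k, IsCyclicSeq ![i, j, k] → IsAntiCyclicSeq ![f i, f j, f k]) ↔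
      ∀ i j k, StrictCyc i j k → ¬ StrictCyc (f i) (f j) (f k) := by
  simp only [isCyclicSeq_triple, isAntiCyclicSeq_triple]
  refine forall₃_congr fun i j k => ?_
  unfold StrictCyc
  grind

theorem val_finRotate {m : ℕ} (i : Fin (m + 1)) :
    ((i : ℕ) < m ∧ (finRotate (m + 1) i : ℕ) = i + 1) ∨
      ((i : ℕ) = m ∧ (finRotate (m + 1) i : ℕ) = 0) := by
  rw [coe_finRotate]
  have := i.isLt
  split_ifs with h <;> simp only [Fin.ext_iff, Fin.val_last] at h <;> omega

/-- A function with `f a < f b` has an ascent on the interval from `a` to `b`. -/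
theorem exists_ascent_of_le {β : Type*} [LinearOrder β] {m : ℕ} (f : Fin (m + 1) → β)
    {a b : Fin (m + 1)} (hab : a ≤ b) (hf : f a < f b) :
    ∃ i, f i < f (finRotate (m + 1) i) ∧ a ≤ i ∧ i < b := by
  induction b using Fin.induction with
  | zero => exact absurd hf (by rw [Fin.le_zero_iff.mp hab]; exact lt_irrefl _)
  | succ b ih =>
    have hb : finRotate (m + 1) b.castSucc = b.succ := by
      rw [finRotate_apply, Fin.coeSucc_eq_succ]
    have hab' : a ≤ b.castSucc := by
      rcases hab.lt_or_eq with h | h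
      · exact Fin.le_castSucc_iff.mpr h
      · exact absurd hf (by rw [h]; exact lt_irrefl _)
    by_cases h : f b.castSucc < f b.succ
    · exact ⟨b.castSucc, by rwa [hb], hab', Fin.castSucc_lt_succ⟩
    · obtain ⟨i, hi, hai, hib⟩ := ih hab' (hf.trans_le (not_lt.mp h))
      exact ⟨i, hi, hai, hib.trans Fin.castSucc_lt_succ⟩

/-- A function with `f a < f b` has an ascent on the cyclic interval from `a` to `b`. -/
theorem exists_ascent {β : Type*} [LinearOrder β] {m : ℕ} (f : Fin (m + 1) → β)
    {a b : Fin (m + 1)} (hf : f a < f b) :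
    ∃ i, f i < f (finRotate (m + 1) i) ∧
      ((a ≤ i ∧ i < b) ∨ (b < a ∧ a ≤ i) ∨ (b < a ∧ i < b)) := by
  rcases le_or_gt a b with hab | hba
  · obtain ⟨i, hi, h⟩ := exists_ascent_of_le f hab hf
    exact ⟨i, hi, .inl h⟩
  by_cases h₁ : f a < f (Fin.last m)
  · obtain ⟨i, hi, h⟩ := exists_ascent_of_le f (Fin.le_last a) h₁
    exact ⟨i, hi, .inr (.inl ⟨hba, h.1⟩)⟩
  by_cases h₂ : f 0 < f b
  · obtain ⟨i, hi, h⟩ := exists_ascent_of_le f (Fin.zero_le b) h₂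
    exact ⟨i, hi, .inr (.inr ⟨hba, h.2⟩)⟩
  · refine ⟨Fin.last m, ?_, .inr (.inl ⟨hba, Fin.le_last a⟩)⟩
    rw [finRotate_last]
    exact (not_lt.mp h₁).trans_lt (hf.trans_le (not_lt.mp h₂))

theorem IsAntiCyclicSeq.not_strictCyc {β : Type*} [LinearOrder β] {m : ℕ} {f : Fin (m + 1) → β}
    (hf : IsAntiCyclicSeq f) {i j k : Fin (m + 1)} (h : StrictCyc i j k) :
    ¬ StrictCyc (f i) (f j) (f k) := by
  have key : ∀ x y z : Fin (m + 1), StrictCyc x y z → f x < f y → f y < f z → False := by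
    intro x y z hxyz hxy hyz
    obtain ⟨p, hp, hp'⟩ := exists_ascent f hxy
    obtain ⟨q, hq, hq'⟩ := exists_ascent f hyz
    have hpq : p = q := Finset.card_le_one.mp hf p (by simpa using hp) q (by simpa using hq)
    subst hpq
    unfold StrictCyc at hxyz
    omega
  have hrot : ∀ x y z : Fin (m + 1), StrictCyc x y z → StrictCyc y z x := by
    unfold StrictCyc
    tauto
  rintro (⟨h₁, h₂⟩ | ⟨h₁, h₂⟩ | ⟨h₁, h₂⟩)
  · exact key i j k h h₁ h₂
  · exact key j k i (hrot _ _ _ h) h₁ h₂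
  · exact key k i j (hrot _ _ _ (hrot _ _ _ h)) h₁ h₂

/-- If `f` sends no cyclic triple to a strictly cyclic one, then an ascent of `f` goes from the
minimum of `f` to its maximum. -/
theorem mem_Icc_of_ascent {β : Type*} [LinearOrder β] {m : ℕ} {f : Fin (m + 1) → β}
    (hf : ∀ i j k, StrictCyc i j k → ¬ StrictCyc (f i) (f j) (f k)) {p : Fin (m + 1)}
    (hp : f p < f (finRotate (m + 1) p)) (r : Fin (m + 1)) :
    f r ∈ Set.Icc (f p) (f (finRotate (m + 1) p)) := by
  rcases eq_or_ne r p with rfl | h₁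
  · exact ⟨le_rfl, hp.le⟩
  rcases eq_or_ne r (finRotate (m + 1) p) with rfl | h₂
  · exact ⟨hp.le, le_rfl⟩
  have hcyc : StrictCyc p (finRotate (m + 1) p) r := by
    have := val_finRotate p
    unfold StrictCyc
    omega
  have := hf _ _ _ hcyc
  unfold StrictCyc at this
  constructor <;> by_contra! h <;> tauto

theorem isAntiCyclicSeq_of_not_strictCyc {β : Type*} [LinearOrder β] {m : ℕ}
    {f : Fin (m + 1) → β} (him : 3 ≤ (Finset.univ.image f).card)
    (hf : ∀ i j k, StrictCyc i j k → ¬ StrictCyc (f i) (f j) (f k)) :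
    IsAntiCyclicSeq f := by
  refine Finset.card_le_one.mpr fun p hp q hq => ?_
  simp only [Finset.mem_filter, Finset.mem_univ, true_and] at hp hq
  by_contra hpq
  have hP := mem_Icc_of_ascent hf hp
  have hQ := mem_Icc_of_ascent hf hq
  have hmin : f q = f p := le_antisymm (hQ p).1 (hP q).1
  have hmax : f (finRotate (m + 1) q) = f (finRotate (m + 1) p) :=
    le_antisymm (hP _).2 (hQ _).2
  obtain ⟨v, hv, hv'⟩ := Finset.exists_mem_notMem_of_card_lt_card
    (s := {f p, f (finRotate (m + 1) p)}) (Finset.card_le_two.trans_lt him)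
  obtain ⟨r, -, rfl⟩ := Finset.mem_image.mp hv
  simp only [Finset.mem_insert, Finset.mem_singleton, not_or] at hv'
  have hlo : f p < f r := (hP r).1.lt_of_ne (Ne.symm hv'.1)
  have hhi : f r < f (finRotate (m + 1) p) := (hP r).2.lt_of_ne hv'.2
  have hrp : r ≠ p := fun h => hv'.1 (by rw [h])
  have hrq : r ≠ q := fun h => hv'.1 (by rw [h, hmin])
  have hrp' : r ≠ finRotate (m + 1) p := fun h => hv'.2 (by rw [← h])
  have hrq' : r ≠ finRotate (m + 1) q := fun h => hv'.2 (by rw [← hmax, ← h])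
  have hcyc : StrictCyc p r (finRotate (m + 1) q) ∨ StrictCyc q r (finRotate (m + 1) p) := by
    have hpq' : p ≠ finRotate (m + 1) q := fun h => hp.ne (by rw [← hmax, ← h])
    have hqp' : q ≠ finRotate (m + 1) p := fun h => hp.ne (by rw [← h, hmin])
    have := val_finRotate p
    have := val_finRotate q
    unfold StrictCyc
    omega
  rcases hcyc with h | h
  · exact hf _ _ _ h (.inl ⟨hlo, by rwa [hmax]⟩)
  · exact hf _ _ _ h (.inl ⟨by rwa [hmin], hhi⟩)

/-- For `n ≥ 1` and `α : [n] → [n]` with at least 3 elements in its image,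
`α` is orientation-reversing iff the image of every cyclic triple is anti-cyclic. -/
theorem or_iff_anticyclic_triples (n : ℕ) (hn : 1 ≤ n) (α : Fin n → Fin n)
    (him : 3 ≤ (Finset.univ.image α).card) :
    IsAntiCyclicSeq α ↔
      ∀ i j k : Fin n, IsCyclicSeq ![i, j, k] → IsAntiCyclicSeq ![α i, α j, α k] := by
  obtain ⟨m, rfl⟩ := Nat.exists_eq_add_of_le' hn
  rw [forall_isCyclicSeq_triple_iff]
  exact ⟨fun h _ _ _ => h.not_strictCyc, isAntiCyclicSeq_of_not_strictCyc him⟩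
end

section
/- Let α ∈ OP_n (α is orientation-preserving) and let S be an oriented sequence with entries in [n] such that the image sequence Sα has at least 3 distinct entries. Then Sα has the same orientation as S and this orientation is unique: if S is cyclic then Sα is cyclic and not anti-cyclic, and if S is anti-cyclic then Sα is anti-cyclic and not cyclic. -/
section CyclicSequences

variable {t : ℕ} {β : Type*} [LinearOrder β]

/-- An upper set `U` of indices witnesses that `a` is cyclic when `a` is monotone both on `U` and
on its complement, and the values on `U` lie below those on the complement. -/
def IsCyclicCut (a : Fin t → β) (U : Fin t → Prop) : Prop :=
  ∀ i j : Fin t, i ≤ j →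
    (U i → U j) ∧ ((U i ↔ U j) → a i ≤ a j) ∧ (¬ U i → U j → a j ≤ a i)

lemma isCyclicSeq_iff_unique {a : Fin t → β} :
    IsCyclicSeq a ↔
      ∀ i j : Fin t, a (finRotate t i) < a i → a (finRotate t j) < a j → i = j := by
  simp only [IsCyclicSeq, Finset.card_le_one, Finset.mem_filter, Finset.mem_univ, true_and]
  grind

lemma finRotate_of_val_lt {i : Fin t} (h : i.val + 1 < t) :
    finRotate t i = ⟨i.val + 1, h⟩ := by
  obtain ⟨m, rfl⟩ : ∃ m, t = m + 1 := ⟨t - 1, by omega⟩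
  exact finRotate_of_lt (by omega)

lemma finRotate_of_val_eq {i : Fin t} (h : i.val + 1 = t) :
    finRotate t i = ⟨0, by omega⟩ := by
  obtain ⟨m, rfl⟩ : ∃ m, t = m + 1 := ⟨t - 1, by omega⟩
  obtain rfl : i = Fin.last m := Fin.ext (by simp only [Fin.val_last]; omega)
  exact finRotate_last

lemma le_of_no_descent {a : Fin t → β} {i j : Fin t} (hij : i ≤ j)
    (h : ∀ d, i ≤ d → d < j → a d ≤ a (finRotate t d)) : a i ≤ a j := by
  obtain ⟨j, hj⟩ := j
  induction j with
  | zero =>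
    obtain rfl : i = ⟨0, hj⟩ := Fin.ext (by simpa [Fin.le_def] using hij)
    exact le_rfl
  | succ k ih =>
    rcases hij.eq_or_lt with rfl | hlt
    · exact le_rfl
    · have hik : i ≤ ⟨k, by omega⟩ := by simp only [Fin.lt_def, Fin.le_def] at hlt ⊢; omega
      refine (ih (by omega) hik fun d h₁ h₂ => h d h₁ ?_).trans ?_
      · simp only [Fin.lt_def] at h₂ ⊢; omega
      · have := h ⟨k, by omega⟩ hik (by simp [Fin.lt_def])
        rwa [finRotate_of_val_lt (i := ⟨k, by omega⟩) hj] at this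

lemma isCyclicSeq_iff_exists_cut {a : Fin t → β} :
    IsCyclicSeq a ↔ ∃ U, IsCyclicCut a U := by
  rw [isCyclicSeq_iff_unique]
  constructor
  · intro h
    refine ⟨fun i => ∃ d, d < i ∧ a (finRotate t d) < a d, fun i j hij => ⟨?_, ?_, ?_⟩⟩
    · rintro ⟨d, hd, had⟩
      exact ⟨d, hd.trans_le hij, had⟩
    · intro hU
      refine le_of_no_descent hij fun d h₁ h₂ => ?_
      by_contra! hd
      obtain ⟨e, he, hae⟩ := hU.2 ⟨d, h₂, hd⟩
      obtain rfl := h d e hd hae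
      exact absurd h₁ (not_le.2 he)
    · rintro hi ⟨d, hd, had⟩
      have hdi : i ≤ d := by
        by_contra! hlt
        exact hi ⟨d, hlt, had⟩
      have ht : 0 < t := i.pos
      let z : Fin t := ⟨0, ht⟩
      let l : Fin t := ⟨t - 1, by omega⟩
      have hjl : j ≤ l := by simp only [Fin.le_def, l]; omega
      have hlast : a l ≤ a z := by
        by_contra! hlt
        have hrot : finRotate t l = z := finRotate_of_val_eq (by simp only [l]; omega)
        have hdl : d = l := h d l had (hrot ▸ hlt)
        exact absurd hjl (not_le.2 (hdl ▸ hd))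
      have h₁ : a j ≤ a l := by
        refine le_of_no_descent hjl fun e he _ => ?_
        by_contra! hlt
        obtain rfl := h d e had hlt
        exact absurd he (not_le.2 hd)
      have h₂ : a z ≤ a i := by
        refine le_of_no_descent (by simp [Fin.le_def, z]) fun e _ he => ?_
        by_contra! hlt
        obtain rfl := h d e had hlt
        exact absurd hdi (not_le.2 he)
      exact h₁.trans (hlast.trans h₂)
  · rintro ⟨U, hU⟩
    have key : ∀ i j : Fin t, i < j → a (finRotate t i) < a i →
        a (finRotate t j) < a j → False := by
      intro i j hij hi hj
      have hi' : i.val + 1 < t := by have := j.isLt; simp only [Fin.lt_def] at hij; omega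
      rw [finRotate_of_val_lt hi'] at hi
      have hsi := hU i ⟨i.val + 1, hi'⟩ (by simp [Fin.le_def])
      have hsj := hU ⟨i.val + 1, hi'⟩ j (by simp only [Fin.lt_def, Fin.le_def] at *; omega)
      by_cases hj' : j.val + 1 < t
      · rw [finRotate_of_val_lt hj'] at hj
        have := hU j ⟨j.val + 1, hj'⟩ (by simp [Fin.le_def])
        grind
      · rw [finRotate_of_val_eq (by omega)] at hj
        have h₀ := hU ⟨0, i.pos⟩ i (by simp [Fin.le_def])
        have h₁ := hU ⟨0, i.pos⟩ j (by simp [Fin.le_def])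
        grind
    intro i j hi hj
    rcases lt_trichotomy i j with h | h | h
    · exact (key i j h hi hj).elim
    · exact h
    · exact (key j i h hj hi).elim

lemma isAntiCyclicSeq_iff_rev {a : Fin t → β} :
    IsAntiCyclicSeq a ↔ IsCyclicSeq (fun i => a i.rev) := by
  have hrot : ∀ i : Fin t, finRotate t (finRotate t i).rev = i.rev := by
    intro i
    by_cases hi : i.val + 1 < t
    · rw [finRotate_of_val_lt hi, finRotate_of_val_lt (by simp only [Fin.val_rev]; omega)]
      ext; simp only [Fin.val_rev]; omega
    · have := i.isLt
      rw [finRotate_of_val_eq (i := i) (by omega),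
        finRotate_of_val_eq (by simp only [Fin.val_rev]; omega)]
      ext; simp only [Fin.val_rev]; omega
  unfold IsAntiCyclicSeq IsCyclicSeq
  rw [← Finset.card_equiv ((finRotate t).trans Fin.revPerm)
    (s := Finset.univ.filter fun i : Fin t => a (finRotate t i).rev < a i.rev)]
  intro i
  simp only [Finset.mem_filter, Finset.mem_univ, true_and, Equiv.trans_apply, Fin.revPerm_apply,
    hrot]

lemma IsCyclicSeq.triple_s2 {a : Fin t → β} (h : IsCyclicSeq a) {i j k : Fin t} (hij : i ≤ j)
    (hjk : j ≤ k) :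
    (a i ≤ a j ∧ a j ≤ a k) ∨ (a j ≤ a k ∧ a k ≤ a i) ∨ (a k ≤ a i ∧ a i ≤ a j) := by
  obtain ⟨U, hU⟩ := isCyclicSeq_iff_exists_cut.1 h
  have h₁ := hU i j hij
  have h₂ := hU j k hjk
  have h₃ := hU i k (hij.trans hjk)
  grind

lemma IsCyclicSeq.card_image_le_two {a : Fin t → β} (h : IsCyclicSeq a)
    (h' : IsAntiCyclicSeq a) : (Finset.univ.image a).card ≤ 2 := by
  rw [isAntiCyclicSeq_iff_rev] at h'
  have key : ∀ i j k : Fin t, i ≤ j → j ≤ k → a i ≠ a j → a i ≠ a k → a j ≠ a k → False := by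
    intro i j k hij hjk h₁ h₂ h₃
    have c₁ := h.triple_s2 hij hjk
    have c₂ := h'.triple_s2 (Fin.rev_le_rev.2 hjk) (Fin.rev_le_rev.2 hij)
    simp only [Fin.rev_rev] at c₂
    grind
  by_contra! hc
  obtain ⟨x, hx, y, hy, z, hz, hxy, hxz, hyz⟩ := Finset.two_lt_card.1 hc
  simp only [Finset.mem_image, Finset.mem_univ, true_and] at hx hy hz
  obtain ⟨i, rfl⟩ := hx
  obtain ⟨j, rfl⟩ := hy
  obtain ⟨k, rfl⟩ := hz
  rcases le_total i j with h₁ | h₁ <;> rcases le_total i k with h₂ | h₂ <;>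
    rcases le_total j k with h₃ | h₃
  · exact key i j k h₁ h₃ hxy hxz hyz
  · exact key i k j h₂ h₃ hxz hxy hyz.symm
  · exact key i j k h₁ h₃ hxy hxz hyz
  · exact key k i j h₂ h₁ hxz.symm hyz.symm hxy
  · exact key j i k h₁ h₂ hxy.symm hyz hxz
  · exact key j i k h₁ h₂ hxy.symm hyz hxz
  · exact key j k i h₃ h₂ hyz hxy.symm hxz.symm
  · exact key k j i h₃ h₁ hyz.symm hxz.symm hxy.symm

lemma IsCyclicSeq.comp {n : ℕ} {f : Fin n → β} (hf : IsCyclicSeq f) {S : Fin t → Fin n}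
    (hS : IsCyclicSeq S) : IsCyclicSeq (fun i => f (S i)) := by
  obtain ⟨U, hU⟩ := isCyclicSeq_iff_exists_cut.1 hS
  obtain ⟨V, hV⟩ := isCyclicSeq_iff_exists_cut.1 hf
  rw [isCyclicSeq_iff_exists_cut]
  rcases Nat.eq_zero_or_pos t with rfl | ht
  · exact ⟨fun _ => True, fun i => i.elim0⟩
  let z : Fin t := ⟨0, ht⟩
  have hz : ∀ i, z ≤ i := fun i => by simp [Fin.le_def, z]
  wlog hUz : ¬ U z generalizing U
  · refine this (fun _ => False) (fun i j hij => ?_) not_false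
    have u := hU i j hij
    have ui := hU z i (hz i)
    have uj := hU z j (hz j)
    grind
  by_cases h₀ : V (S z)
  · refine ⟨fun i => U i ∧ V (S i), fun i j hij => ?_⟩
    have u := hU i j hij
    have ui := hU z i (hz i)
    have uj := hU z j (hz j)
    have v := hV (S i) (S j)
    have v' := hV (S j) (S i)
    have vi := hV (S z) (S i)
    have vj := hV (S z) (S j)
    grind
  · refine ⟨fun i => U i ∨ V (S i), fun i j hij => ?_⟩
    have u := hU i j hij
    have ui := hU z i (hz i)
    have uj := hU z j (hz j)
    have v := hV (S i) (S j)
    have v' := hV (S j) (S i)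
    have vi := hV (S i) (S z)
    have vj := hV (S j) (S z)
    grind

lemma IsCyclicSeq.comp_antiCyclic {n : ℕ} {f : Fin n → β} (hf : IsCyclicSeq f)
    {S : Fin t → Fin n} (hS : IsAntiCyclicSeq S) : IsAntiCyclicSeq (fun i => f (S i)) :=
  isAntiCyclicSeq_iff_rev.2 (hf.comp (isAntiCyclicSeq_iff_rev.1 hS))

end CyclicSequences

/-- If `α ∈ OP_n` and `S` is oriented with `|Sα| ≥ 3`, then `Sα` has the
same, unique, orientation as `S`. -/
theorem op_preserves_orientation (n t : ℕ) (α : Fin n → Fin n) (hα : IsCyclicSeq α)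
    (S : Fin t → Fin n) (hS : IsOrientedSeq S)
    (him : 3 ≤ (Finset.univ.image (fun i => α (S i))).card) :
    (IsCyclicSeq S → IsCyclicSeq (fun i => α (S i)) ∧ ¬ IsAntiCyclicSeq (fun i => α (S i))) ∧
    (IsAntiCyclicSeq S → IsAntiCyclicSeq (fun i => α (S i)) ∧ ¬ IsCyclicSeq (fun i => α (S i))) := by
  have hnot : IsCyclicSeq (fun i => α (S i)) → ¬ IsAntiCyclicSeq (fun i => α (S i)) :=
    fun h h' => absurd (h.card_image_le_two h') (by omega)
  exact ⟨fun h => ⟨hα.comp h, hnot (hα.comp h)⟩,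
    fun h => ⟨hα.comp_antiCyclic h, fun h' => hnot h' (hα.comp_antiCyclic h)⟩⟩
end

section
/- Let α ∈ OR_n (α is orientation-reversing) and let S be an oriented sequence with entries in [n] such that the image sequence Sα has at least 3 distinct entries. Then Sα has the orientation opposite to that of S and this orientation is unique: if S is cyclic then Sα is anti-cyclic and not cyclic, and if S is anti-cyclic then Sα is cyclic and not anti-cyclic. -/
/-- The triple `x, y, z` is, up to rotation, strictly decreasing. -/
def IsDescTriple {β : Type*} [LinearOrder β] (x y z : β) : Prop :=
  (y < x ∧ z < y) ∨ (z < y ∧ x < z) ∨ (x < z ∧ y < x)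

/-- The triple `x, y, z` is, up to rotation, strictly increasing. -/
def IsAscTriple {β : Type*} [LinearOrder β] (x y z : β) : Prop :=
  (x < y ∧ y < z) ∨ (y < z ∧ z < x) ∨ (z < x ∧ x < y)

/-- The periodic extension of a finite sequence to `ℕ`. -/
def periodicExt {t : ℕ} [NeZero t] {β : Type*} (a : Fin t → β) (m : ℕ) : β :=
  a (Fin.ofNat t m)

section

variable {t : ℕ} [NeZero t] {β : Type*}

theorem periodicExt_val (a : Fin t → β) (i : Fin t) : periodicExt a i = a i := by
  simp [periodicExt]

theorem periodicExt_add_self (a : Fin t → β) (m : ℕ) :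
    periodicExt a (m + t) = periodicExt a m := by
  unfold periodicExt
  congr 1
  ext
  simp

theorem finRotate_ofNat (m : ℕ) : finRotate t (Fin.ofNat t m) = Fin.ofNat t (m + 1) := by
  obtain ⟨s, rfl⟩ := Nat.exists_eq_succ_of_ne_zero (NeZero.ne t)
  rw [finRotate_apply]
  ext
  simp [Fin.val_add]

theorem periodicExt_finRotate (a : Fin t → β) (i : Fin t) :
    a (finRotate t i) = periodicExt a (i + 1) := by
  rw [periodicExt, ← finRotate_ofNat]
  simp

variable [LinearOrder β]

theorem exists_descent {f : ℕ → β} {i j : ℕ} (hij : i ≤ j) (h : f j < f i) :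
    ∃ m, i ≤ m ∧ m < j ∧ f (m + 1) < f m := by
  by_contra! hc
  have key : ∀ k, i ≤ k → k ≤ j → f i ≤ f k := fun k hik => by
    induction k, hik using Nat.le_induction with
    | base => exact fun _ => le_rfl
    | succ k hk ih => exact fun hkj => (ih (by omega)).trans (hc k hk (by omega))
  exact (key j hij le_rfl).not_gt h

theorem IsCyclicSeq.not_two_descents {a : Fin t → β} (ha : IsCyclicSeq a) {p q : ℕ}
    (hpq : p < q) (hqp : q < p + t) (hp : periodicExt a (p + 1) < periodicExt a p)
    (hq : periodicExt a (q + 1) < periodicExt a q) : False := by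
  have h := Finset.card_le_one.1 ha (Fin.ofNat t p) (by
      rw [Finset.mem_filter, finRotate_ofNat]
      exact ⟨Finset.mem_univ _, hp⟩)
    (Fin.ofNat t q) (by
      rw [Finset.mem_filter, finRotate_ofNat]
      exact ⟨Finset.mem_univ _, hq⟩)
  have hmod : p ≡ q [MOD t] := congrArg Fin.val h
  have := Nat.le_of_dvd (by omega) ((Nat.modEq_iff_dvd' hpq.le).1 hmod)
  omega

theorem IsCyclicSeq.not_isDescTriple {a : Fin t → β} (ha : IsCyclicSeq a) {i j k : ℕ}
    (hij : i ≤ j) (hjk : j ≤ k) (hki : k ≤ i + t) :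
    ¬ IsDescTriple (periodicExt a i) (periodicExt a j) (periodicExt a k) := by
  have hi := periodicExt_add_self a i
  rintro (⟨h₁, h₂⟩ | ⟨h₁, h₂⟩ | ⟨h₁, h₂⟩)
  · obtain ⟨p, _, _, hp⟩ := exists_descent hij h₁
    obtain ⟨q, _, _, hq⟩ := exists_descent hjk h₂
    exact ha.not_two_descents (by omega) (by omega) hp hq
  · obtain ⟨p, _, _, hp⟩ := exists_descent hjk h₁
    obtain ⟨q, _, _, hq⟩ := exists_descent hki (hi ▸ h₂)
    exact ha.not_two_descents (by omega) (by omega) hp hq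
  · obtain ⟨p, _, _, hp⟩ := exists_descent hij h₂
    obtain ⟨q, _, _, hq⟩ := exists_descent hki (hi ▸ h₁)
    exact ha.not_two_descents (by omega) (by omega) hp hq

theorem IsAntiCyclicSeq.not_isAscTriple {a : Fin t → β} (ha : IsAntiCyclicSeq a) {i j k : ℕ}
    (hij : i ≤ j) (hjk : j ≤ k) (hki : k ≤ i + t) :
    ¬ IsAscTriple (periodicExt a i) (periodicExt a j) (periodicExt a k) :=
  IsCyclicSeq.not_isDescTriple (β := βᵒᵈ) (a := a) ha hij hjk hki

theorem eq_or_eq_of_two_descents {a : Fin t → β}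
    (h : ∀ i j k : ℕ, i ≤ j → j ≤ k → k ≤ i + t →
      ¬ IsDescTriple (periodicExt a i) (periodicExt a j) (periodicExt a k))
    {p q : Fin t} (hpq : p < q) (hp : a (finRotate t p) < a p) (hq : a (finRotate t q) < a q)
    (c : Fin t) : a c = a p ∨ a c = a (finRotate t p) := by
  simp only [periodicExt_finRotate a] at hp hq ⊢
  rw [← periodicExt_val a p] at hp ⊢
  rw [← periodicExt_val a q] at hq
  rw [← periodicExt_val a c]
  have hpq' : (p : ℕ) < q := hpq
  have hqt := q.isLt
  have hct := c.isLt
  have h₁ := h p (p + 1) q (by omega) (by omega) (by omega)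
  have h₂ := h p (p + 1) (q + 1) (by omega) (by omega) (by omega)
  have h₃ := h p q (q + 1) (by omega) (by omega) (by omega)
  have h₄ := h (p + 1) q (q + 1) (by omega) (by omega) (by omega)
  have key : ∀ d : ℕ, p ≤ d → d ≤ p + t → periodicExt a d = periodicExt a p ∨
      periodicExt a d = periodicExt a (p + 1) := by
    intro d hpd hdp
    rcases hpd.eq_or_lt with rfl | hpd
    · exact Or.inl rfl
    have h₅ := h p (p + 1) d (by omega) (by omega) (by omega)
    rcases le_total d q with hdq | hdq
    · have h₆ := h p d (q + 1) (by omega) (by omega) (by omega)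
      clear h
      generalize periodicExt a p = x at *
      generalize periodicExt a (p + 1) = y at *
      generalize periodicExt a q = z at *
      generalize periodicExt a (q + 1) = w at *
      generalize periodicExt a d = v at *
      unfold IsDescTriple at *
      grind
    · have h₆ := h (p + 1) q d (by omega) (by omega) (by omega)
      clear h
      generalize periodicExt a p = x at *
      generalize periodicExt a (p + 1) = y at *
      generalize periodicExt a q = z at *
      generalize periodicExt a (q + 1) = w at *
      generalize periodicExt a d = v at *
      unfold IsDescTriple at *
      grind
  rcases le_total (p : ℕ) c with hc | hc
  · exact key c hc (by omega)
  · rw [← periodicExt_add_self a c]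
    exact key (c + t) (by omega) (by omega)

theorem isCyclicSeq_of_not_isDescTriple {a : Fin t → β}
    (him : 3 ≤ (Finset.univ.image a).card)
    (h : ∀ i j k : ℕ, i ≤ j → j ≤ k → k ≤ i + t →
      ¬ IsDescTriple (periodicExt a i) (periodicExt a j) (periodicExt a k)) :
    IsCyclicSeq a := by
  by_contra hc
  obtain ⟨p, hp, q, hq, hne⟩ := Finset.one_lt_card.1 (not_le.1 hc)
  simp only [Finset.mem_filter, Finset.mem_univ, true_and] at hp hq
  wlog hpq : p < q generalizing p q
  · exact this q p hne.symm hq hp (by order)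
  have hsub : Finset.univ.image a ⊆ {a p, a (finRotate t p)} := by
    intro x hx
    obtain ⟨c, -, rfl⟩ := Finset.mem_image.1 hx
    simpa using eq_or_eq_of_two_descents h hpq hp hq c
  have := (Finset.card_le_card hsub).trans Finset.card_le_two
  omega

theorem isAntiCyclicSeq_of_not_isAscTriple {a : Fin t → β}
    (him : 3 ≤ (Finset.univ.image a).card)
    (h : ∀ i j k : ℕ, i ≤ j → j ≤ k → k ≤ i + t →
      ¬ IsAscTriple (periodicExt a i) (periodicExt a j) (periodicExt a k)) :
    IsAntiCyclicSeq a :=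
  isCyclicSeq_of_not_isDescTriple (β := βᵒᵈ) (a := a) him h

theorem IsCyclicSeq.not_isAntiCyclicSeq {a : Fin t → β} (ha : IsCyclicSeq a)
    (him : 3 ≤ (Finset.univ.image a).card) : ¬ IsAntiCyclicSeq a := by
  intro hb
  obtain ⟨x, hx, y, hy, z, hz, hxy, hxz, hyz⟩ := Finset.two_lt_card.1 him
  simp only [Finset.mem_image, Finset.mem_univ, true_and] at hx hy hz
  obtain ⟨i, rfl⟩ := hx
  obtain ⟨j, rfl⟩ := hy
  obtain ⟨k, rfl⟩ := hz
  have key : ∀ i j k : Fin t, i ≤ j → j ≤ k → a i ≠ a j → a i ≠ a k → a j ≠ a k → False := by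
    intro i j k hij hjk hxy hxz hyz
    have h₁ := ha.not_isDescTriple (i := i) (j := j) (k := k) hij hjk (by omega)
    have h₂ := hb.not_isAscTriple (i := i) (j := j) (k := k) hij hjk (by omega)
    simp only [periodicExt_val] at h₁ h₂
    unfold IsDescTriple at h₁
    unfold IsAscTriple at h₂
    grind
  rcases le_total i j with hij | hij <;> rcases le_total j k with hjk | hjk <;>
    rcases le_total i k with hik | hik <;> grind

end

theorem IsAntiCyclicSeq.not_isAscTriple_apply {n : ℕ} {β : Type*} [LinearOrder β] {α : Fin n → β}
    (hα : IsAntiCyclicSeq α) {x y z : Fin n} (h : IsAscTriple x y z) :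
    ¬ IsAscTriple (α x) (α y) (α z) := by
  have : NeZero n := ⟨by have := x.isLt; omega⟩
  have key : ∀ u v w : Fin n, u < v → v < w → ¬ IsAscTriple (α u) (α v) (α w) := by
    intro u v w huv hvw
    simpa only [periodicExt_val] using
      hα.not_isAscTriple (i := u) (j := v) (k := w) (by omega) (by omega) (by omega)
  rcases h with ⟨h₁, h₂⟩ | ⟨h₁, h₂⟩ | ⟨h₁, h₂⟩ <;> have := key _ _ _ h₁ h₂ <;>
    unfold IsAscTriple at * <;> tauto

/-- If `α ∈ OR_n` and `S` is oriented with `|Sα| ≥ 3`, then `Sα` has the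
opposite, unique, orientation to that of `S`. -/
theorem or_reverses_orientation (n t : ℕ) (α : Fin n → Fin n) (hα : IsAntiCyclicSeq α)
    (S : Fin t → Fin n) (hS : IsOrientedSeq S)
    (him : 3 ≤ (Finset.univ.image (fun i => α (S i))).card) :
    (IsCyclicSeq S → IsAntiCyclicSeq (fun i => α (S i)) ∧ ¬ IsCyclicSeq (fun i => α (S i))) ∧
    (IsAntiCyclicSeq S → IsCyclicSeq (fun i => α (S i)) ∧ ¬ IsAntiCyclicSeq (fun i => α (S i))) := by
  have : NeZero t := ⟨by rintro rfl; simp at him⟩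
  constructor
  · intro hc
    have h : IsAntiCyclicSeq (fun i => α (S i)) := by
      refine isAntiCyclicSeq_of_not_isAscTriple him fun i j k hij hjk hki hasc => ?_
      have h₁ := hc.not_isDescTriple hij hjk hki
      change IsAscTriple (α (periodicExt S i)) (α (periodicExt S j)) (α (periodicExt S k)) at hasc
      refine hα.not_isAscTriple_apply ?_ hasc
      generalize periodicExt S i = x at *
      generalize periodicExt S j = y at *
      generalize periodicExt S k = z at *
      unfold IsDescTriple at h₁
      unfold IsAscTriple at *
      grind
    exact ⟨h, fun h' => h'.not_isAntiCyclicSeq him h⟩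
  · intro hc
    have h : IsCyclicSeq (fun i => α (S i)) := by
      refine isCyclicSeq_of_not_isDescTriple him fun i j k hij hjk hki hdesc => ?_
      have h₁ := hc.not_isAscTriple hij hjk hki
      change IsDescTriple (α (periodicExt S i)) (α (periodicExt S j)) (α (periodicExt S k)) at hdesc
      generalize periodicExt S i = x at *
      generalize periodicExt S j = y at *
      generalize periodicExt S k = z at *
      have h₂ : IsAscTriple z y x := by
        unfold IsDescTriple at hdesc
        unfold IsAscTriple at *
        grind
      have h₃ := hα.not_isAscTriple_apply h₂
      unfold IsDescTriple at hdesc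
      unfold IsAscTriple at h₃
      tauto
    exact ⟨h, h.not_isAntiCyclicSeq him⟩
end

section
/- The set OP_n of orientation-preserving maps of [n] is closed under composition: if α, β ∈ OP_n then their composite αβ (first α, then β) belongs to OP_n; hence OP_n is a subsemigroup of the full transformation semigroup T_n. -/
/-- `A` is a degree-one monotone lift of `a`, viewed as a self-map of the cycle `ℤ/nℤ`. -/
def IsCyclicLift {n : ℕ} [NeZero n] (a : Fin n → Fin n) (A : ℕ → ℕ) : Prop :=
  Monotone A ∧ (∀ i, A (i + n) = A i + n) ∧ ∀ i, A i % n = (a (Fin.ofNat n i)).val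

theorem finRotate_ofNat_s4 {n : ℕ} [NeZero n] (i : ℕ) :
    finRotate n (Fin.ofNat n i) = Fin.ofNat n (i + 1) := by
  rw [finRotate_apply]
  ext
  simp [Fin.val_add]

theorem IsCyclicLift.comp {n : ℕ} [NeZero n] {a b : Fin n → Fin n} {A B : ℕ → ℕ}
    (hb : IsCyclicLift b B) (ha : IsCyclicLift a A) : IsCyclicLift (b ∘ a) (B ∘ A) := by
  refine ⟨hb.1.comp ha.1, fun i => ?_, fun i => ?_⟩
  · simp [ha.2.1, hb.2.1]
  · have h : Fin.ofNat n (A i) = a (Fin.ofNat n i) := Fin.ext (ha.2.2 i)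
    simp only [Function.comp_apply, hb.2.2, h]

theorem IsCyclicLift.isCyclicSeq {n : ℕ} [NeZero n] {a : Fin n → Fin n} {A : ℕ → ℕ}
    (h : IsCyclicLift a A) : IsCyclicSeq a := by
  obtain ⟨hmono, hper, hmod⟩ := h
  have hn : 0 < n := Nat.pos_of_neZero n
  have hdesc (i : Fin n) (hi : a (finRotate n i) < a i) : A i / n + 1 ≤ A (i + 1) / n := by
    have hi' : Fin.ofNat n i = i := by simp
    rw [← hi', finRotate_ofNat_s4, Fin.lt_def, ← hmod, ← hmod] at hi
    have hle : A i ≤ A (i + 1) := hmono (Nat.le_succ _)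
    by_contra hcon
    have hq : A (i + 1) / n ≤ A i / n := by omega
    have := Nat.mul_le_mul_left n hq
    have := Nat.div_add_mod (A i) n
    have := Nat.div_add_mod (A (i + 1)) n
    omega
  have hnot (i j : Fin n) (hi : a (finRotate n i) < a i) (hj : a (finRotate n j) < a j) :
      ¬ i < j := by
    intro hij
    have h₁ := hdesc i hi
    have h₂ := hdesc j hj
    have h₃ : A (i + 1) / n ≤ A j / n := Nat.div_le_div_right (hmono hij)
    have h₄ : A (j + 1) / n ≤ A (i + n) / n := Nat.div_le_div_right (hmono (by omega))
    rw [hper, Nat.add_div_right _ hn] at h₄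
    omega
  refine Finset.card_le_one.2 fun i hi j hj => ?_
  simp only [Finset.mem_filter, Finset.mem_univ, true_and] at hi hj
  exact le_antisymm (not_lt.1 (hnot j i hj hi)) (not_lt.1 (hnot i j hi hj))

theorem IsCyclicSeq.exists_isCyclicLift {n : ℕ} [NeZero n] {a : Fin n → Fin n}
    (h : IsCyclicSeq a) : ∃ A, IsCyclicLift a A := by
  have hn : 0 < n := Nat.pos_of_neZero n
  obtain ⟨p, hp⟩ : ∃ p, ∀ i, i ≠ p → a i ≤ a (finRotate n i) := by
    obtain ⟨p, hp⟩ := Finset.card_le_one_iff_subset_singleton.1 h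
    refine ⟨p, fun i hi => not_lt.1 fun hlt => hi ?_⟩
    simpa using hp (Finset.mem_filter.2 ⟨Finset.mem_univ i, hlt⟩)
  refine ⟨fun i => (a (Fin.ofNat n i)).val + n * ((i + (n - 1 - p)) / n),
    monotone_nat_of_le_succ fun i => ?_, fun i => ?_, fun i => ?_⟩
  · by_cases hi : Fin.ofNat n i = p
    · have hmod : i % n = p := congrArg Fin.val hi
      have hdiv := Nat.div_add_mod i n
      have h₁ : (i + (n - 1 - p)) / n = i / n := by
        rw [show i + (n - 1 - p) = n - 1 + n * (i / n) by omega,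
          Nat.add_mul_div_left _ _ hn, Nat.div_eq_of_lt (by omega), zero_add]
      have h₂ : (i + 1 + (n - 1 - p)) / n = i / n + 1 := by
        rw [show i + 1 + (n - 1 - p) = n + n * (i / n) by omega,
          Nat.add_mul_div_left _ _ hn, Nat.div_self hn, add_comm]
      rw [h₁, h₂, Nat.mul_add]
      omega
    · have hle := hp _ hi
      rw [finRotate_ofNat_s4] at hle
      exact Nat.add_le_add hle (Nat.mul_le_mul_left n (Nat.div_le_div_right (by omega)))
  · have hmod : Fin.ofNat n (i + n) = Fin.ofNat n i := by ext; simp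
    simp only [hmod]
    rw [add_right_comm i, Nat.add_div_right _ hn, Nat.mul_succ, add_assoc]
  · simp only [Nat.add_mul_mod_self_left]
    exact Nat.mod_eq_of_lt (Fin.is_lt _)

/-- `OP_n` is closed under composition (maps written on the right:
`αβ` is first `α`, then `β`). -/
theorem op_closed_under_composition (n : ℕ) (α β : Fin n → Fin n)
    (hα : IsCyclicSeq α) (hβ : IsCyclicSeq β) :
    IsCyclicSeq (fun x => β (α x)) := by
  rcases Nat.eq_zero_or_pos n with rfl | hn
  · simp [IsCyclicSeq]
  · have : NeZero n := ⟨hn.ne'⟩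
    obtain ⟨A, hA⟩ := hα.exists_isCyclicLift
    obtain ⟨B, hB⟩ := hβ.exists_isCyclicLift
    exact (hB.comp hA).isCyclicSeq
end

section
/- The set P_n = OP_n ∪ OR_n of all orientation-preserving or orientation-reversing maps of [n] is closed under composition: if α, β ∈ P_n then αβ ∈ P_n; hence P_n is a subsemigroup of the full transformation semigroup T_n. -/
theorem isAntiCyclicSeq_iff_toDual {t : ℕ} {α : Type*} [LinearOrder α] (a : Fin t → α) :
    IsAntiCyclicSeq a ↔ IsCyclicSeq (fun i => OrderDual.toDual (a i)) :=
  Iff.rfl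

theorem isCyclicSeq_iff_forall {t : ℕ} {α : Type*} [LinearOrder α] (a : Fin t → α) :
    IsCyclicSeq a ↔
      ∀ i j, a (finRotate t i) < a i → a (finRotate t j) < a j → i = j := by
  simp only [IsCyclicSeq, Finset.card_le_one, Finset.mem_filter, Finset.mem_univ, true_and]
  exact ⟨fun h i j hi hj => h i hi j hj, fun h i hi j hj => h i j hi hj⟩

theorem val_finRotate_cases_s5 {m : ℕ} (i : Fin (m + 1)) :
    (i.val < m ∧ (finRotate (m + 1) i).val = i.val + 1) ∨
      (i.val = m ∧ (finRotate (m + 1) i).val = 0) := by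
  rcases Nat.lt_succ_iff_lt_or_eq.mp i.isLt with h | h
  · exact Or.inl ⟨h, by
      rw [coe_finRotate_of_ne_last (by intro h'; simp [h'] at h)]⟩
  · refine Or.inr ⟨h, ?_⟩
    have : i = Fin.last m := Fin.ext h
    rw [this, finRotate_last]
    rfl

theorem finRotate_rev_finRotate {t : ℕ} (i : Fin t) :
    finRotate t (Fin.rev (finRotate t i)) = Fin.rev i := by
  cases t with
  | zero => exact i.elim0
  | succ m =>
    have h1 := val_finRotate_cases_s5 i
    have h2 := val_finRotate_cases_s5 (Fin.rev (finRotate (m + 1) i))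
    have h3 := Fin.val_rev (finRotate (m + 1) i)
    have h4 := Fin.val_rev i
    apply Fin.ext
    omega

/-- Reversing the indices of a cyclic sequence makes it anti-cyclic. -/
theorem IsCyclicSeq.comp_rev {t : ℕ} {α : Type*} [LinearOrder α] {a : Fin t → α}
    (ha : IsCyclicSeq a) : IsAntiCyclicSeq (fun i => a (Fin.rev i)) := by
  rw [isAntiCyclicSeq_iff_toDual, isCyclicSeq_iff_forall]
  rw [isCyclicSeq_iff_forall] at ha
  intro i j hi hj
  have key := ha (Fin.rev (finRotate t i)) (Fin.rev (finRotate t j))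
    (by rw [finRotate_rev_finRotate]; exact hi) (by rw [finRotate_rev_finRotate]; exact hj)
  exact (finRotate t).injective (Fin.rev_injective key)

theorem IsAntiCyclicSeq.comp_rev {t : ℕ} {α : Type*} [LinearOrder α] {a : Fin t → α}
    (ha : IsAntiCyclicSeq a) : IsCyclicSeq (fun i => a (Fin.rev i)) :=
  IsCyclicSeq.comp_rev (α := αᵒᵈ) ha

/-- Reversing the values of an anti-cyclic sequence makes it cyclic. -/
theorem IsAntiCyclicSeq.rev_comp {t n : ℕ} {a : Fin t → Fin n}
    (ha : IsAntiCyclicSeq a) : IsCyclicSeq (fun i => Fin.rev (a i)) := by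
  simpa only [IsCyclicSeq, IsAntiCyclicSeq, Fin.rev_lt_rev] using ha

/-- A cyclic sequence has a cut point `e`: it is monotone up to `e` and after `e`, and no value
after `e` exceeds a value up to `e`. -/
theorem IsCyclicSeq.exists_cut {m : ℕ} {α : Type*} [LinearOrder α] {a : Fin (m + 1) → α}
    (ha : IsCyclicSeq a) :
    ∃ e : Fin (m + 1), ∀ x y, x ≤ y →
      ((y ≤ e ∨ e < x) → a x ≤ a y) ∧ (x ≤ e → e < y → a y ≤ a x) := by
  rw [isCyclicSeq_iff_forall] at ha
  obtain ⟨e, he⟩ : ∃ e : Fin (m + 1), ∀ i, i ≠ e → a i ≤ a (finRotate (m + 1) i) := by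
    by_cases h : ∃ e, a (finRotate (m + 1) e) < a e
    · obtain ⟨e, he⟩ := h
      exact ⟨e, fun i hi => not_lt.mp fun hlt => hi (ha i e hlt he)⟩
    · push Not at h
      exact ⟨0, fun i _ => h i⟩
  have mono : ∀ k : ℕ, ∀ x y : Fin (m + 1), y.val = x.val + k → (y ≤ e ∨ e < x) →
      a x ≤ a y := by
    intro k
    induction k with
    | zero =>
      intro x y hxy _
      rw [Fin.ext hxy]
    | succ k ih =>
      intro x y hxy hc
      have hx := val_finRotate_cases_s5 x
      have hne : x ≠ e := by
        rintro rfl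
        rcases hc with hc | hc <;> omega
      exact (he x hne).trans (ih _ y (by omega) (by omega))
  refine ⟨e, fun x y hxy => ⟨fun hc => mono (y.val - x.val) x y (by omega) hc, fun hx hy => ?_⟩⟩
  have hl := he (Fin.last m) (by rintro rfl; exact absurd hy (not_lt.mpr (Fin.le_last y)))
  rw [finRotate_last] at hl
  have h1 := mono (m - y.val) y (Fin.last m) (by simp; omega) (Or.inr hy)
  have h2 := mono x.val 0 x (by simp) (Or.inl hx)
  exact h1.trans (hl.trans h2)

theorem IsCyclicSeq.comp_s5 {t n : ℕ} {γ : Type*} [LinearOrder γ] {a : Fin t → Fin n}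
    {b : Fin n → γ} (ha : IsCyclicSeq a) (hb : IsCyclicSeq b) :
    IsCyclicSeq (fun i => b (a i)) := by
  rw [isCyclicSeq_iff_forall]
  cases t with
  | zero => exact fun i => i.elim0
  | succ t =>
  cases n with
  | zero => exact (a 0).elim0
  | succ n =>
  obtain ⟨e, he⟩ := ha.exists_cut
  obtain ⟨d, hd⟩ := hb.exists_cut
  -- `b` can only drop from `x` to `y` if the arc going up from `x` to `y` crosses the cut `d`.
  have cross : ∀ x y, b y < b x → (x ≤ d ∧ d < y) ∨ (y < x ∧ (x ≤ d ∨ d < y)) := by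
    intro x y hlt
    by_contra hcon
    rcases le_total x y with hxy | hxy
    · exact absurd ((hd x y hxy).1 (by omega)) (not_le.mpr hlt)
    · rcases hxy.eq_or_lt with rfl | hxy'
      · exact lt_irrefl _ hlt
      · exact absurd ((hd y x hxy).2 (by omega) (by omega)) (not_le.mpr hlt)
  have main : ∀ i j, i < j → b (a (finRotate _ i)) < b (a i) →
      b (a (finRotate _ j)) < b (a j) → False := by
    intro i j hij hi hj
    have ci := cross _ _ hi
    have cj := cross _ _ hj
    have ri := val_finRotate_cases_s5 i
    have rj := val_finRotate_cases_s5 j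
    generalize finRotate (t + 1) i = i' at *
    generalize finRotate (t + 1) j = j' at *
    have hi' : i < i' ∧ i' ≤ j := by omega
    -- The endpoints of the two steps take values in cyclic order.
    have quad : (a i ≤ a i' ∧ a i' ≤ a j ∧ a j ≤ a j') ∨ (a i' ≤ a j ∧ a j ≤ a j' ∧ a j' ≤ a i) ∨
        (a j ≤ a j' ∧ a j' ≤ a i ∧ a i ≤ a i') ∨ (a j' ≤ a i ∧ a i ≤ a i' ∧ a i' ≤ a j) := by
      rcases rj with rj | rj
      · have hj' : j < j' := by omega
        rcases lt_or_ge e i with h | h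
        · exact Or.inl ⟨(he i i' (by omega)).1 (by omega), (he i' j (by omega)).1 (by omega),
            (he j j' (by omega)).1 (by omega)⟩
        have hji : e < j' → a j' ≤ a i := fun h' => (he i j' (by omega)).2 h h'
        rcases lt_or_ge e i' with h | h
        · exact Or.inr (Or.inl ⟨(he i' j (by omega)).1 (by omega),
            (he j j' (by omega)).1 (by omega), hji (by omega)⟩)
        rcases lt_or_ge e j with h | h
        · exact Or.inr (Or.inr (Or.inl ⟨(he j j' (by omega)).1 (by omega), hji (by omega),
            (he i i' (by omega)).1 (by omega)⟩))
        rcases lt_or_ge e j' with h | h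
        · exact Or.inr (Or.inr (Or.inr ⟨hji (by omega), (he i i' (by omega)).1 (by omega),
            (he i' j (by omega)).1 (by omega)⟩))
        · exact Or.inl ⟨(he i i' (by omega)).1 (by omega), (he i' j (by omega)).1 (by omega),
            (he j j' (by omega)).1 (by omega)⟩
      · have hj' : j' ≤ i := by omega
        rcases lt_or_ge e i with h | h
        · exact Or.inl ⟨(he i i' (by omega)).1 (by omega), (he i' j (by omega)).1 (by omega),
            (he j' j (by omega)).2 (by omega) (by omega)⟩
        have hji : a j' ≤ a i := (he j' i hj').1 (by omega)
        rcases lt_or_ge e i' with h | h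
        · exact Or.inr (Or.inl ⟨(he i' j (by omega)).1 (by omega),
            (he j' j (by omega)).2 (by omega) (by omega), hji⟩)
        rcases lt_or_ge e j with h | h
        · exact Or.inr (Or.inr (Or.inl ⟨(he j' j (by omega)).2 (by omega) (by omega), hji,
            (he i i' (by omega)).1 (by omega)⟩))
        · exact Or.inr (Or.inr (Or.inr ⟨hji, (he i i' (by omega)).1 (by omega),
            (he i' j (by omega)).1 (by omega)⟩))
    clear he hd cross hi hj
    omega
  intro i j hi hj
  rcases lt_trichotomy i j with h | h | h
  · exact (main i j h hi hj).elim
  · exact h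
  · exact (main j i h hj hi).elim

/-- `P_n = OP_n ∪ OR_n` is closed under composition (maps written on the
right: `αβ` is first `α`, then `β`). -/
theorem p_closed_under_composition (n : ℕ) (α β : Fin n → Fin n)
    (hα : IsCyclicSeq α ∨ IsAntiCyclicSeq α) (hβ : IsCyclicSeq β ∨ IsAntiCyclicSeq β) :
    IsCyclicSeq (fun x => β (α x)) ∨ IsAntiCyclicSeq (fun x => β (α x)) := by
  rcases hα with hα | hα <;> rcases hβ with hβ | hβ
  · exact Or.inl (hα.comp_s5 hβ)
  · exact Or.inr (IsCyclicSeq.comp_s5 (γ := (Fin n)ᵒᵈ) hα hβ)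
  · have h := IsCyclicSeq.comp_s5 (γ := (Fin n)ᵒᵈ) hα.rev_comp hβ.comp_rev
    simp only [Fin.rev_rev] at h
    exact Or.inr h
  · have h := hα.rev_comp.comp_s5 hβ.comp_rev
    simp only [Fin.rev_rev] at h
    exact Or.inl h
end

section
/- A map α : [n] → [n] lies in OP_n ∩ OR_n if and only if α ∈ P_n and the image of α has at most 2 elements; that is, OP_n ∩ OR_n = {α ∈ P_n : |im(α)| ≤ 2}. -/
open Fin.NatCast in
theorem exists_and_not_finRotate {t : ℕ} {p : Fin t → Prop} {a b : Fin t}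
    (ha : p a) (hb : ¬ p b) : ∃ i, p i ∧ ¬ p (finRotate t i) := by
  cases t with
  | zero => exact a.elim0
  | succ t =>
    by_contra! h
    have key : ∀ k : ℕ, p (a + (k : Fin (t + 1))) := by
      intro k
      induction k with
      | zero => simpa using ha
      | succ k ih =>
        have := h _ ih
        rwa [finRotate_apply, add_assoc, ← Nat.cast_succ] at this
    have := key (b - a).val
    rw [Fin.cast_val_eq_self, add_sub_cancel] at this
    exact hb this

/-- A cyclic and anti-cyclic sequence does not take three distinct values. -/
theorem IsCyclicSeq.not_lt_lt {t : ℕ} {β : Type*} [LinearOrder β] {s : Fin t → β}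
    (hc : IsCyclicSeq s) (ha : IsAntiCyclicSeq s) {i j k : Fin t} (hij : s i < s j) :
    ¬ s j < s k := by
  intro hjk
  rw [IsCyclicSeq, Finset.card_le_one] at hc
  rw [IsAntiCyclicSeq, Finset.card_le_one] at ha
  simp only [Finset.mem_filter, Finset.mem_univ, true_and] at hc ha
  obtain ⟨l, hl, hl'⟩ := exists_and_not_finRotate (p := fun x => s x = s j) rfl hij.ne
  rcases lt_or_gt_of_ne hl' with h | h
  · obtain ⟨m, hm, hm'⟩ := exists_and_not_finRotate (p := fun x => s j < s x) hjk (lt_irrefl _)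
    obtain rfl := hc l (h.trans_eq hl.symm) m ((not_lt.1 hm').trans_lt hm)
    exact hm.ne' hl
  · obtain ⟨m, hm, hm'⟩ := exists_and_not_finRotate (p := fun x => s x < s j) hij (lt_irrefl _)
    obtain rfl := ha l (hl.trans_lt h) m (hm.trans_le (not_lt.1 hm'))
    exact hm.ne hl

/-- A sequence with at most two values has as many cyclic descents as cyclic ascents. -/
theorem card_descents_eq_card_ascents {t : ℕ} {β : Type*} [LinearOrder β] {s : Fin t → β}
    (h : (Finset.univ.image s).card ≤ 2) :
    (Finset.univ.filter fun i : Fin t => s (finRotate t i) < s i).card =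
      (Finset.univ.filter fun i : Fin t => s i < s (finRotate t i)).card := by
  rcases isEmpty_or_nonempty (Fin t) with _ | _
  · simp
  obtain ⟨m, hm⟩ := Finite.exists_max s
  have lt_iff : ∀ i j, s i < s j ↔ s j = s m ∧ s i ≠ s m := by
    refine fun i j => ⟨fun hij => ?_, fun ⟨hj, hi⟩ => hj ▸ lt_of_le_of_ne (hm i) hi⟩
    refine ⟨?_, (hij.trans_le (hm j)).ne⟩
    by_contra hj
    refine absurd h (not_le.2 (Finset.two_lt_card.2 ⟨s i, ?_, s j, ?_, s m, ?_, hij.ne,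
      (hij.trans_le (hm j)).ne, hj⟩)) <;> simp
  simp only [lt_iff, ne_eq, ← Finset.filter_filter]
  have hrot : (Finset.univ.filter fun i => s (finRotate t i) = s m).card =
      (Finset.univ.filter fun i => s i = s m).card :=
    Finset.card_equiv (finRotate t) (by simp)
  have h₁ := Finset.card_filter_add_card_filter_not (s := Finset.univ.filter fun i => s i = s m)
    (fun i => s (finRotate t i) = s m)
  have h₂ := Finset.card_filter_add_card_filter_not
    (s := Finset.univ.filter fun i => s (finRotate t i) = s m) (fun i => s i = s m)
  rw [Finset.filter_comm] at h₂
  omega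

/-- `OP_n ∩ OR_n = {α ∈ P_n : |im α| ≤ 2}`. -/
theorem op_inter_or (n : ℕ) (α : Fin n → Fin n) :
    IsCyclicSeq α ∧ IsAntiCyclicSeq α ↔
      (IsCyclicSeq α ∨ IsAntiCyclicSeq α) ∧ (Finset.univ.image α).card ≤ 2 := by
  constructor
  · rintro ⟨hc, ha⟩
    refine ⟨Or.inl hc, ?_⟩
    by_contra! h
    obtain ⟨x, hx, y, hy, z, hz, hxy, hxz, hyz⟩ := Finset.two_lt_card.1 h
    simp only [Finset.mem_image, Finset.mem_univ, true_and] at hx hy hz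
    obtain ⟨i, rfl⟩ := hx
    obtain ⟨j, rfl⟩ := hy
    obtain ⟨k, rfl⟩ := hz
    have key := fun a b c => hc.not_lt_lt ha (i := a) (j := b) (k := c)
    rcases hxy.lt_or_gt with h₁ | h₁ <;> rcases hxz.lt_or_gt with h₂ | h₂ <;>
      rcases hyz.lt_or_gt with h₃ | h₃ <;> grind
  · rintro ⟨h, hcard⟩
    have heq := card_descents_eq_card_ascents hcard
    have hiff : IsCyclicSeq α ↔ IsAntiCyclicSeq α := by
      rw [IsCyclicSeq, IsAntiCyclicSeq, heq]
    rw [hiff, or_self] at h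
    exact ⟨hiff.2 h, h⟩
end

section
/- Let n ≥ 1 and place the points of [n] clockwise on the unit circle in the plane, with k ∈ [n] at the point p_k = (cos(2πk/n), −sin(2πk/n)). For a, b, c, d ∈ [n], the chords [p_a, p_c] and [p_b, p_d] (closed line segments) have nonempty intersection if and only if the quadruple S = (a, b, c, d) is oriented. -/
/-- The point of `[n]` labelled `k`, placed clockwise on the unit circle. -/
noncomputable def circlePt (n : ℕ) (k : Fin n) : ℝ × ℝ :=
  (Real.cos (2 * Real.pi * (k.val : ℝ) / n), -Real.sin (2 * Real.pi * (k.val : ℝ) / n))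

/-- `α` has the *chord property* if it preserves nonempty intersection of chords. -/
def ChordProperty (n : ℕ) (α : Fin n → Fin n) : Prop :=
  ∀ a b c d : Fin n,
    (segment ℝ (circlePt n a) (circlePt n c) ∩ segment ℝ (circlePt n b) (circlePt n d)).Nonempty →
    (segment ℝ (circlePt n (α a)) (circlePt n (α c)) ∩
      segment ℝ (circlePt n (α b)) (circlePt n (α d))).Nonempty

/-- Twice the signed area of the triangle with vertices `p`, `q`, `r`. -/
def signedArea (p q r : ℝ × ℝ) : ℝ :=
  (q.1 - p.1) * (r.2 - p.2) - (q.2 - p.2) * (r.1 - p.1)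

theorem signedArea_swap (p q r : ℝ × ℝ) : signedArea q p r = -signedArea p q r := by
  simp only [signedArea]; ring

/-- If `b` and `d` lie strictly on the same side of the line `pq`, the segment `bd` misses `pq`. -/
theorem segment_inter_empty_of_same_side {p q b d : ℝ × ℝ}
    (h : 0 < signedArea p q b * signedArea p q d) :
    ¬ (segment ℝ p q ∩ segment ℝ b d).Nonempty := by
  rintro ⟨x, ⟨s, t, -, -, hst, rfl⟩, ⟨u, v, hu, hv, huv, hx⟩⟩
  have h₁ := congrArg Prod.fst hx
  have h₂ := congrArg Prod.snd hx
  simp only [Prod.fst_add, Prod.snd_add, Prod.smul_fst, Prod.smul_snd, smul_eq_mul] at h₁ h₂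
  have key : u * signedArea p q b + v * signedArea p q d = 0 := by
    obtain rfl : s = 1 - t := by linarith
    obtain rfl : u = 1 - v := by linarith
    simp only [signedArea]
    linear_combination (q.1 - p.1) * h₂ - (q.2 - p.2) * h₁
  rcases mul_pos_iff.mp h with ⟨hb, hd⟩ | ⟨hb, hd⟩ <;>
    rcases hu.eq_or_lt with rfl | hu <;> nlinarith

/-- If each of two segments has its endpoints strictly on opposite sides of the line through the
other, then the segments meet. -/
theorem segment_inter_nonempty_of_opposite_sides {a b c d : ℝ × ℝ}
    (h₁ : signedArea a c b * signedArea a c d < 0)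
    (h₂ : signedArea b d a * signedArea b d c < 0) :
    (segment ℝ a c ∩ segment ℝ b d).Nonempty := by
  wlog hb : 0 < signedArea a c b generalizing a c
  · rw [segment_symm ℝ a c]
    refine this ?_ (by linarith) ?_
    · rw [signedArea_swap a c, signedArea_swap a c]; linarith
    · rw [signedArea_swap]
      exact neg_pos.mpr (lt_of_le_of_ne (not_lt.mp hb) fun h => by simp [h] at h₁)
  have hd : signedArea a c d < 0 := by
    by_contra! h; nlinarith
  have hsum : signedArea b d c - signedArea b d a = signedArea a c b - signedArea a c d := by
    simp only [signedArea]; ring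
  obtain ⟨ha, hc⟩ : signedArea b d a < 0 ∧ 0 < signedArea b d c := by
    rcases mul_neg_iff.mp h₂ with ⟨h, h'⟩ | h
    · linarith
    · exact h
  set D := signedArea a c b - signedArea a c d with hD
  have hDpos : 0 < D := by linarith
  refine ⟨(signedArea b d c / D) • a + (-signedArea b d a / D) • c,
    ⟨_, _, by positivity, div_nonneg (by linarith) hDpos.le, ?_, rfl⟩,
    ⟨-signedArea a c d / D, signedArea a c b / D, div_nonneg (by linarith) hDpos.le,
      by positivity, ?_, ?_⟩⟩
  · field_simp; linarith
  · field_simp; linarith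
  · ext <;>
      simp only [Prod.fst_add, Prod.snd_add, Prod.smul_fst, Prod.smul_snd, smul_eq_mul] <;>
      field_simp <;> simp only [signedArea] <;> ring

/-- Half the signed length of the chord from `x` to `y`. -/
noncomputable def halfChord (n : ℕ) (x y : Fin n) : ℝ :=
  Real.sin (Real.pi * y.val / n - Real.pi * x.val / n)

theorem halfChord_swap {n : ℕ} (x y : Fin n) : halfChord n y x = -halfChord n x y := by
  rw [halfChord, halfChord, ← Real.sin_neg, neg_sub]

theorem halfChord_self {n : ℕ} (x : Fin n) : halfChord n x x = 0 := by
  simp [halfChord]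

theorem halfChord_pos_of_lt {n : ℕ} {x y : Fin n} (h : x < y) : 0 < halfChord n x y := by
  have hn : (0 : ℝ) < n := by exact_mod_cast x.pos
  have hxy : (x.val : ℝ) < y.val := by exact_mod_cast h
  have hy : (y.val : ℝ) < n := by exact_mod_cast y.isLt
  have hx : (0 : ℝ) ≤ x.val := by positivity
  have e : Real.pi * y.val / n - Real.pi * x.val / n = Real.pi * ((y.val - x.val) / n) := by ring
  rw [halfChord, e]
  apply Real.sin_pos_of_pos_of_lt_pi
  · exact mul_pos Real.pi_pos (div_pos (by linarith) hn)
  · have : ((y.val : ℝ) - x.val) / n < 1 := by rw [div_lt_one hn]; linarith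
    nlinarith [Real.pi_pos]

theorem halfChord_pos_iff {n : ℕ} {x y : Fin n} : 0 < halfChord n x y ↔ x < y := by
  refine ⟨fun h => ?_, halfChord_pos_of_lt⟩
  rcases lt_trichotomy x y with hxy | rfl | hxy
  · exact hxy
  · simp [halfChord_self] at h
  · have := halfChord_pos_of_lt hxy
    rw [halfChord_swap] at this
    linarith

theorem halfChord_neg_iff {n : ℕ} {x y : Fin n} : halfChord n x y < 0 ↔ y < x := by
  rw [← halfChord_pos_iff, halfChord_swap x y, neg_pos]

theorem halfChord_eq_zero_iff {n : ℕ} {x y : Fin n} : halfChord n x y = 0 ↔ x = y := by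
  refine ⟨fun h => ?_, fun h => h ▸ halfChord_self x⟩
  rcases lt_trichotomy x y with hxy | hxy | hxy
  · exact absurd h (halfChord_pos_iff.mpr hxy).ne'
  · exact hxy
  · exact absurd h (halfChord_neg_iff.mpr hxy).ne

theorem four_mul_sin_mul_sin_mul_sin_add (A B : ℝ) :
    4 * (Real.sin A * Real.sin B * Real.sin (A + B)) =
      Real.sin (2 * A) + Real.sin (2 * B) - Real.sin (2 * (A + B)) := by
  rw [mul_add, Real.sin_add, Real.sin_add (2 * A), Real.cos_two_mul, Real.cos_two_mul,
    Real.cos_sq', Real.cos_sq', Real.sin_two_mul, Real.sin_two_mul]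
  ring

theorem signedArea_circlePt {n : ℕ} (x y z : Fin n) :
    signedArea (circlePt n x) (circlePt n y) (circlePt n z) =
      -4 * (halfChord n x y * halfChord n y z * halfChord n x z) := by
  have e (k : Fin n) : 2 * Real.pi * (k.val : ℝ) / n = 2 * (Real.pi * k.val / n) := by ring
  simp only [signedArea, circlePt, halfChord, e]
  have h := four_mul_sin_mul_sin_mul_sin_add (Real.pi * y.val / n - Real.pi * x.val / n)
    (Real.pi * z.val / n - Real.pi * y.val / n)
  rw [sub_add_sub_cancel'] at h
  simp only [mul_sub, Real.sin_sub (2 * _)] at h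
  linear_combination h

theorem circlePt_injective {n : ℕ} : Function.Injective (circlePt n) := by
  intro x y h
  rw [← halfChord_eq_zero_iff]
  have e (k : Fin n) : 2 * Real.pi * (k.val : ℝ) / n = 2 * (Real.pi * k.val / n) := by ring
  have h₁ := congrArg Prod.fst h
  have h₂ := congrArg Prod.snd h
  simp only [circlePt, e] at h₁ h₂
  have h₃ := Real.cos_sub (2 * (Real.pi * y.val / n)) (2 * (Real.pi * x.val / n))
  rw [h₁, neg_inj.mp h₂, ← mul_sub, Real.cos_two_mul] at h₃
  have h₄ := Real.sin_sq_add_cos_sq (2 * (Real.pi * y.val / n))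
  have h₅ := Real.sin_sq_add_cos_sq (Real.pi * y.val / n - Real.pi * x.val / n)
  rw [halfChord]
  exact pow_eq_zero_iff two_ne_zero |>.mp (by linarith)

theorem isOrientedSeq_iff_halfChord_prod_nonpos {n : ℕ} (a b c d : Fin n) :
    IsOrientedSeq ![a, b, c, d] ↔
      halfChord n a b * halfChord n b c * halfChord n c d * halfChord n d a ≤ 0 := by
  rw [← not_lt]
  have hr0 : finRotate 4 0 = 1 := by decide
  have hr1 : finRotate 4 1 = 2 := by decide
  have hr2 : finRotate 4 2 = 3 := by decide
  have hr3 : finRotate 4 3 = 0 := by decide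
  simp only [IsOrientedSeq, IsCyclicSeq, IsAntiCyclicSeq, Finset.card_filter, Fin.sum_univ_four,
    hr0, hr1, hr2, hr3, mul_pos_iff, mul_neg_iff, halfChord_pos_iff, halfChord_neg_iff]
  simp only [Matrix.cons_val, Fin.lt_def]
  split_ifs <;> omega

theorem chords_meet_iff_halfChord_prod_nonpos {n : ℕ} (a b c d : Fin n) :
    (segment ℝ (circlePt n a) (circlePt n c) ∩
        segment ℝ (circlePt n b) (circlePt n d)).Nonempty ↔
      halfChord n a b * halfChord n b c * halfChord n c d * halfChord n d a ≤ 0 := by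
  set Q := halfChord n a b * halfChord n b c * halfChord n c d * halfChord n d a with hQ
  have hac : signedArea (circlePt n a) (circlePt n c) (circlePt n b) *
      signedArea (circlePt n a) (circlePt n c) (circlePt n d) =
      16 * halfChord n a c ^ 2 * Q := by
    rw [signedArea_circlePt, signedArea_circlePt, hQ, halfChord_swap b c, halfChord_swap a d]
    ring
  have hbd : signedArea (circlePt n b) (circlePt n d) (circlePt n a) *
      signedArea (circlePt n b) (circlePt n d) (circlePt n c) =
      16 * halfChord n b d ^ 2 * Q := by
    rw [signedArea_circlePt, signedArea_circlePt, hQ, halfChord_swap a b, halfChord_swap c d]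
    ring
  have hpos {x y : Fin n} (h : x ≠ y) : 0 < 16 * halfChord n x y ^ 2 := by
    have := mt halfChord_eq_zero_iff.mp h
    positivity
  constructor
  · contrapose!
    intro h
    rw [← Set.not_nonempty_iff_eq_empty]
    by_cases h₁ : a = c
    · by_cases h₂ : b = d
      · subst h₁ h₂
        simp only [segment_same, Set.singleton_inter_nonempty, Set.mem_singleton_iff]
        intro hab
        simp [hQ, circlePt_injective hab, halfChord_self] at h
      · rw [Set.inter_comm]
        exact segment_inter_empty_of_same_side (hbd ▸ mul_pos (hpos h₂) h)
    · exact segment_inter_empty_of_same_side (hac ▸ mul_pos (hpos h₁) h)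
  · intro h
    rcases h.lt_or_eq with h | h
    · have h₁ : a ≠ c := by
        rintro rfl
        rw [hQ, halfChord_swap a b, halfChord_swap a d] at h
        nlinarith [sq_nonneg (halfChord n a b * halfChord n a d)]
      have h₂ : b ≠ d := by
        rintro rfl
        rw [hQ, halfChord_swap a b, halfChord_swap b c] at h
        nlinarith [sq_nonneg (halfChord n a b * halfChord n b c)]
      exact segment_inter_nonempty_of_opposite_sides
        (hac ▸ mul_neg_of_pos_of_neg (hpos h₁) h) (hbd ▸ mul_neg_of_pos_of_neg (hpos h₂) h)
    · simp only [hQ, mul_eq_zero, halfChord_eq_zero_iff] at h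
      rcases h with ((rfl | rfl) | rfl) | rfl
      · exact ⟨_, left_mem_segment .., left_mem_segment ..⟩
      · exact ⟨_, right_mem_segment .., left_mem_segment ..⟩
      · exact ⟨_, right_mem_segment .., right_mem_segment ..⟩
      · exact ⟨_, left_mem_segment .., right_mem_segment ..⟩

/-- Chords `[p_a, p_c]` and `[p_b, p_d]` meet iff the quadruple
`(a, b, c, d)` is oriented. -/
theorem chords_meet_iff_oriented (n : ℕ) (hn : 1 ≤ n) (a b c d : Fin n) :
    (segment ℝ (circlePt n a) (circlePt n c) ∩
        segment ℝ (circlePt n b) (circlePt n d)).Nonempty ↔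
      IsOrientedSeq ![a, b, c, d] := by
  rw [chords_meet_iff_halfChord_prod_nonpos, isOrientedSeq_iff_halfChord_prod_nonpos]
end

section
/- A map α : [n] → [n] has the chord property if and only if for every oriented quadruple S = (a, b, c, d) of elements of [n], the image sequence Sα = (aα, bα, cα, dα) is also oriented. -/
/-- A quadruple is oriented unless its cyclic differences are nonzero with positive product. -/
lemma isOrientedSeq_four_iff {n : ℕ} (a b c d : Fin n) :
    IsOrientedSeq ![a, b, c, d] ↔
      ((b : ℝ) - a) * ((b : ℝ) - c) * (((d : ℝ) - a) * ((d : ℝ) - c)) ≤ 0 := by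
  have key : ∀ x y : Fin n, (x < y ∧ ¬ y < x ∧ SignType.sign ((y : ℝ) - x) = 1) ∨
      (y < x ∧ ¬ x < y ∧ SignType.sign ((y : ℝ) - x) = -1) ∨
      (¬ x < y ∧ ¬ y < x ∧ SignType.sign ((y : ℝ) - x) = 0) := by
    intro x y
    rcases lt_trichotomy x y with h | rfl | h
    · exact Or.inl ⟨h, h.asymm, sign_pos (sub_pos.2 (by exact_mod_cast h))⟩
    · simp
    · exact Or.inr (Or.inl ⟨h, h.asymm, sign_neg (sub_neg.2 (by exact_mod_cast h))⟩)
  have h0 : finRotate 4 0 = 1 := by decide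
  have h1 : finRotate 4 1 = 2 := by decide
  have h2 : finRotate 4 2 = 3 := by decide
  have h3 : finRotate 4 3 = 0 := by decide
  have hprod : ((b : ℝ) - a) * ((b : ℝ) - c) * (((d : ℝ) - a) * ((d : ℝ) - c)) =
      ((b : ℝ) - a) * ((c : ℝ) - b) * (((a : ℝ) - d) * ((d : ℝ) - c)) := by ring
  simp only [IsOrientedSeq, IsCyclicSeq, IsAntiCyclicSeq, Finset.card_filter, Fin.sum_univ_four,
    h0, h1, h2, h3, hprod]
  simp only [Matrix.cons_val]
  rw [← sign_nonpos_iff, sign_mul, sign_mul, sign_mul]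
  rcases key a b with ⟨p, p', hp⟩ | ⟨p, p', hp⟩ | ⟨p, p', hp⟩ <;>
  rcases key b c with ⟨q, q', hq⟩ | ⟨q, q', hq⟩ | ⟨q, q', hq⟩ <;>
  rcases key c d with ⟨r, r', hr⟩ | ⟨r, r', hr⟩ | ⟨r, r', hr⟩ <;>
  rcases key d a with ⟨s, s', hs⟩ | ⟨s, s', hs⟩ | ⟨s, s', hs⟩ <;>
  first
  | order
  | simp only [p, p', q, q', r, r', s, s', hp, hq, hr, hs, if_true, if_false]
    decide

/-- Segments whose endpoints strictly separate each other intersect. -/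
lemma segment_inter_segment_nonempty_of_cross_neg {a b c d : ℝ × ℝ}
    (hac : ((c.1 - a.1) * (b.2 - a.2) - (c.2 - a.2) * (b.1 - a.1)) *
      ((c.1 - a.1) * (d.2 - a.2) - (c.2 - a.2) * (d.1 - a.1)) < 0)
    (hbd : ((d.1 - b.1) * (a.2 - b.2) - (d.2 - b.2) * (a.1 - b.1)) *
      ((d.1 - b.1) * (c.2 - b.2) - (d.2 - b.2) * (c.1 - b.1)) < 0) :
    (segment ℝ a c ∩ segment ℝ b d).Nonempty := by
  set u := (c.1 - a.1) * (b.2 - a.2) - (c.2 - a.2) * (b.1 - a.1) with hu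
  set v := (c.1 - a.1) * (d.2 - a.2) - (c.2 - a.2) * (d.1 - a.1) with hv
  set p := (d.1 - b.1) * (a.2 - b.2) - (d.2 - b.2) * (a.1 - b.1) with hp
  set q := (d.1 - b.1) * (c.2 - b.2) - (d.2 - b.2) * (c.1 - b.1) with hq
  have hw {x y : ℝ} (h : x * y < 0) : 0 ≤ y / (y - x) ∧ 0 ≤ -x / (y - x) ∧
      y / (y - x) + -x / (y - x) = 1 := by
    rcases mul_neg_iff.1 h with ⟨hx, hy⟩ | ⟨hx, hy⟩
    · refine ⟨div_nonneg_of_nonpos (by linarith) (by linarith),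
        div_nonneg_of_nonpos (by linarith) (by linarith), ?_⟩
      rw [← add_div, ← sub_eq_add_neg, div_self (by linarith)]
    · refine ⟨div_nonneg (by linarith) (by linarith),
        div_nonneg (by linarith) (by linarith), ?_⟩
      rw [← add_div, ← sub_eq_add_neg, div_self (by linarith)]
  obtain ⟨h1, h2, h3⟩ := hw hac
  obtain ⟨h4, h5, h6⟩ := hw hbd
  have hqp : q - p ≠ 0 := by
    intro h
    simp [h] at h6
  have hvu : v - u = -(q - p) := by rw [hu, hv, hp, hq]; ring
  refine ⟨_, ⟨_, _, h4, h5, h6, rfl⟩, ⟨_, _, h1, h2, h3, ?_⟩⟩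
  rw [hvu]
  ext
  · simp only [Prod.fst_add, Prod.smul_fst, smul_eq_mul]
    field_simp
    rw [hu, hv, hp, hq]
    ring
  · simp only [Prod.snd_add, Prod.smul_snd, smul_eq_mul]
    field_simp
    rw [hu, hv, hp, hq]
    ring

/-- Half of the angular distance from `circlePt n a` to `circlePt n b`. -/
noncomputable def halfAngle (n : ℕ) (a b : Fin n) : ℝ :=
  Real.pi * (b : ℝ) / n - Real.pi * (a : ℝ) / n

lemma sin_halfAngle_mul_sub_pos {n : ℕ} {a b : Fin n} (h : a ≠ b) :
    0 < Real.sin (halfAngle n a b) * ((b : ℝ) - a) := by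
  have main : ∀ {x y : Fin n}, x < y → 0 < Real.sin (halfAngle n x y) := by
    intro x y hxy
    have hn : (0 : ℝ) < n := by exact_mod_cast x.pos
    have hlt : (x : ℝ) < y := by exact_mod_cast hxy
    have hy : (y : ℝ) < n := by exact_mod_cast y.isLt
    have hx : (0 : ℝ) ≤ (x : ℝ) := by positivity
    have e : halfAngle n x y = Real.pi * (((y : ℝ) - x) / n) := by
      rw [halfAngle]; ring
    rw [e]
    refine Real.sin_pos_of_pos_of_lt_pi
      (mul_pos Real.pi_pos (div_pos (by linarith) hn)) ?_
    exact mul_lt_of_lt_one_right Real.pi_pos ((div_lt_one hn).2 (by linarith))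
  rcases lt_or_gt_of_ne h with h | h
  · exact mul_pos (main h) (sub_pos.2 (by exact_mod_cast h))
  · have e : halfAngle n a b = -halfAngle n b a := by simp [halfAngle]
    rw [e, Real.sin_neg]
    exact mul_pos_of_neg_of_neg (neg_lt_zero.2 (main h)) (sub_neg.2 (by exact_mod_cast h))

/-- The signed area spanned by three points of the circle, as a product of sines. -/
lemma circlePt_cross (n : ℕ) (a b c : Fin n) :
    ((circlePt n c).1 - (circlePt n a).1) * ((circlePt n b).2 - (circlePt n a).2) -
      ((circlePt n c).2 - (circlePt n a).2) * ((circlePt n b).1 - (circlePt n a).1) =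
    4 * Real.sin (halfAngle n a c) * Real.sin (halfAngle n a b) * Real.sin (halfAngle n b c) := by
  have e (k : Fin n) : 2 * Real.pi * (k : ℝ) / n = 2 * (Real.pi * (k : ℝ) / n) := by ring
  simp only [circlePt, halfAngle, e]
  generalize Real.pi * (a : ℝ) / n = x
  generalize Real.pi * (b : ℝ) / n = y
  generalize Real.pi * (c : ℝ) / n = z
  have hc (s t : ℝ) : Real.cos (2 * s) - Real.cos (2 * t) =
      -2 * Real.sin (s + t) * Real.sin (s - t) := by
    rw [Real.cos_sub_cos]; ring_nf
  have hs (s t : ℝ) : -Real.sin (2 * s) - -Real.sin (2 * t) =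
      -2 * Real.sin (s - t) * Real.cos (s + t) := by
    rw [neg_sub_neg, ← neg_sub, Real.sin_sub_sin]; ring_nf
  have hd : Real.sin (z - y) = Real.sin ((z + x) - (y + x)) := by ring_nf
  rw [hc, hc, hs, hs, hd, Real.sin_sub (z + x)]
  ring

/-- An affine function vanishing on the chord through `a` and `c`. -/
lemma exists_affine_chord (n : ℕ) (a c : Fin n) :
    ∃ u v w : ℝ, ∀ k : Fin n, u * (circlePt n k).1 + v * (circlePt n k).2 + w =
      Real.sin (halfAngle n a k) * Real.sin (halfAngle n c k) := by
  have e (k : Fin n) : 2 * Real.pi * (k : ℝ) / n = 2 * (Real.pi * (k : ℝ) / n) := by ring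
  simp only [circlePt, halfAngle, e]
  generalize Real.pi * (a : ℝ) / n = x
  generalize Real.pi * (c : ℝ) / n = z
  refine ⟨-Real.cos (x + z) / 2, Real.sin (x + z) / 2, Real.cos (x - z) / 2, fun k => ?_⟩
  generalize Real.pi * (k : ℝ) / n = y
  have h : Real.cos (2 * y - (x + z)) = Real.cos ((y - x) + (y - z)) := by ring_nf
  have h' : Real.cos (x - z) = Real.cos ((y - z) - (y - x)) := by ring_nf
  rw [Real.cos_sub, Real.cos_add (y - x)] at h
  rw [Real.cos_sub (y - z)] at h'
  linear_combination -h / 2 + h' / 2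

/-- Two chords of the circle meet if and only if their endpoints, taken alternately,
form an oriented quadruple. -/
lemma chords_inter_nonempty_iff {n : ℕ} (a b c d : Fin n) :
    (segment ℝ (circlePt n a) (circlePt n c) ∩
      segment ℝ (circlePt n b) (circlePt n d)).Nonempty ↔ IsOrientedSeq ![a, b, c, d] := by
  rw [isOrientedSeq_four_iff]
  by_cases hab : a = b
  · subst hab
    simpa using ⟨_, left_mem_segment ℝ _ _, left_mem_segment ℝ _ _⟩
  by_cases hcb : c = b
  · subst hcb
    simpa using ⟨_, right_mem_segment ℝ _ _, left_mem_segment ℝ _ _⟩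
  by_cases had : a = d
  · subst had
    simpa using ⟨_, left_mem_segment ℝ _ _, right_mem_segment ℝ _ _⟩
  by_cases hcd : c = d
  · subst hcd
    simpa using ⟨_, right_mem_segment ℝ _ _, right_mem_segment ℝ _ _⟩
  have hpos := mul_pos
    (mul_pos (sin_halfAngle_mul_sub_pos hab) (sin_halfAngle_mul_sub_pos hcb))
    (mul_pos (sin_halfAngle_mul_sub_pos had) (sin_halfAngle_mul_sub_pos hcd))
  set T := Real.sin (halfAngle n a b) * Real.sin (halfAngle n c b) *
    (Real.sin (halfAngle n a d) * Real.sin (halfAngle n c d)) with hT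
  set V := ((b : ℝ) - a) * ((b : ℝ) - c) * (((d : ℝ) - a) * ((d : ℝ) - c)) with hV
  have hTV : 0 < T * V := by
    rw [hT, hV]
    linarith
  constructor
  · rintro ⟨x, ⟨s, t, -, -, hst, rfl⟩, ⟨s', t', hs', ht', hst', hx⟩⟩
    by_contra! hVpos
    have hTpos : 0 < T := pos_of_mul_pos_left hTV hVpos.le
    obtain ⟨u, v, w, huvw⟩ := exists_affine_chord n a c
    have ha := huvw a
    have hc := huvw c
    have hb := huvw b
    have hd := huvw d
    simp only [halfAngle, sub_self, Real.sin_zero, zero_mul, mul_zero] at ha hc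
    have hx1 := congrArg Prod.fst hx
    have hx2 := congrArg Prod.snd hx
    simp only [Prod.fst_add, Prod.smul_fst, Prod.snd_add, Prod.smul_snd, smul_eq_mul] at hx1 hx2
    set f := Real.sin (halfAngle n a b) * Real.sin (halfAngle n c b)
    set g := Real.sin (halfAngle n a d) * Real.sin (halfAngle n c d)
    have hzero : s' * f + t' * g = 0 := by
      rw [← hb, ← hd]
      linear_combination u * hx1 + v * hx2 + s * ha + t * hc + w * hst' - w * hst
    have hcontra : T + (s' * f ^ 2 + t' * g ^ 2) = 0 := by
      rw [hT]
      linear_combination (f + g) * hzero - f * g * hst'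
    have : 0 ≤ s' * f ^ 2 + t' * g ^ 2 := by positivity
    linarith
  · intro hVle
    have hTneg : T < 0 := by
      by_contra! h
      exact absurd hTV (mul_nonpos_of_nonneg_of_nonpos h hVle).not_gt
    have hac : a ≠ c := by
      rintro rfl
      nlinarith [sq_nonneg (Real.sin (halfAngle n a b) * Real.sin (halfAngle n a d))]
    have hbd : b ≠ d := by
      rintro rfl
      nlinarith [sq_nonneg (Real.sin (halfAngle n a b) * Real.sin (halfAngle n c b))]
    have hswap (x y : Fin n) :
        Real.sin (halfAngle n x y) = -Real.sin (halfAngle n y x) := by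
      rw [← Real.sin_neg]
      simp [halfAngle]
    have hsq {x y : Fin n} (h : x ≠ y) : 0 < Real.sin (halfAngle n x y) ^ 2 := by
      have := left_ne_zero_of_mul (sin_halfAngle_mul_sub_pos h).ne'
      positivity
    have h1 := mul_neg_of_pos_of_neg (hsq hac) hTneg
    have h2 := mul_neg_of_pos_of_neg (hsq hbd) hTneg
    apply segment_inter_segment_nonempty_of_cross_neg
    · rw [circlePt_cross, circlePt_cross, hswap b c, hswap d c]
      linarith
    · rw [circlePt_cross, circlePt_cross, hswap b a, hswap b c]
      linarith

/-- `α` has the chord property iff the image of every oriented quadruple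
is oriented. -/
theorem chord_property_iff_oriented_quadruples (n : ℕ) (hn : 1 ≤ n) (α : Fin n → Fin n) :
    ChordProperty n α ↔
      ∀ a b c d : Fin n,
        IsOrientedSeq ![a, b, c, d] → IsOrientedSeq ![α a, α b, α c, α d] := by
  simp only [ChordProperty, chords_inter_nonempty_iff]
end
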